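/- Suppose the v-central condition holds with v(γ) = η_0 γ^α (so E[exp(−v(γ)R_f(Z))] ≤ exp(v(γ)γ) for all γ > 0), and R_f(Z) ∈ [−1/2, 1/2] a.s. Then for all γ > 0 and all 0 < η ≤ v(γ)/2, E[R_f(Z)] ≤ C_η · (−(1/η) log E[exp(−η R_f(Z))]) + ((C_η − 1)/η)·v(γ)·γ, where C_η = 2 + 2η. -/

import Mathlib

open MeasureTheory

/-- Key pointwise inequality. -/
lemma key_pointwise (η x : ℝ) (hη : 0 < η) (hx : x ≤ 1/2) :
    η * x + (2 + 2*η) * (Real.exp (-η * x) - 1)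
      ≤ ((1 + 2*η)/2) * (Real.exp (-(2*η) * x) - 1) := by
  have hsq : Real.exp (-(2*η) * x) = Real.exp (-η * x) ^ 2 := by
    rw [← Real.exp_nat_mul]; congr 1; push_cast; ring
  rw [hsq]
  have hypos := Real.exp_pos (-η * x)
  have hlog : Real.log (Real.exp (-η * x)) = -η * x := Real.log_exp _
  rcases le_total 0 x with h0 | h0
  · have hu : 0 ≤ η * x := mul_nonneg hη.le h0
    have hs := Real.self_le_sinh_iff.2 hu
    rw [Real.sinh_eq] at hs
    have e1 : Real.exp (-η * x) = Real.exp (-(η * x)) := by congr 1; ring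
    have hy1 : Real.exp (-(η * x)) ≤ 1 := Real.exp_le_one_iff.2 (by linarith)
    have hprod : Real.exp (η * x) * Real.exp (-(η * x)) = 1 := by
      rw [← Real.exp_add]; simp
    clear hlog hsq
    rw [e1] at hypos ⊢
    clear e1
    have hux : 2 * (η * x) ≤ η := by nlinarith
    generalize Real.exp (-(η * x)) = y at *
    generalize Real.exp (η * x) = z at *
    generalize η * x = u at *
    have huy : 2 * u * y ≤ 1 - y^2 := by nlinarith
    have h1 : 0 ≤ (η - 2*u) * (y-1)^2 := mul_nonneg (by linarith) (sq_nonneg _)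
    suffices h2 : 0 ≤ (y^2-1)/2 - 2*(y-1) - u + 2*u*(y-1)^2 by nlinarith
    by_cases hc : 1 - 2*(1-y)^2 ≤ 0
    · nlinarith [mul_nonneg hu (neg_nonneg.2 hc)]
    · push Not at hc
      have h3 := mul_le_mul_of_nonneg_right huy hc.le
      have h4 : 0 ≤ y * ((y^2-1)/2 - 2*(y-1) - u + 2*u*(y-1)^2) := by
        nlinarith [mul_nonneg (sq_nonneg (1-y)) (sub_nonneg.2 hy1), sq_nonneg (1-y), mul_nonneg (sq_nonneg (1-y)) hypos.le]
      exact nonneg_of_mul_nonneg_right h4 hypos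
  · have hu : 0 ≤ -η * x := by nlinarith
    have hy1 : 1 ≤ Real.exp (-η * x) := Real.one_le_exp hu
    have hl := Real.le_log_one_add_of_nonneg (sub_nonneg.2 hy1)
    rw [add_sub_cancel, hlog] at hl
    generalize Real.exp (-η * x) = y at *
    have h5 : (y-1)*(3-y)/2 ≤ 2*(y-1)/(y-1+2) := by
      rw [le_div_iff₀ (by linarith)]
      nlinarith [mul_nonneg (sq_nonneg (y-1)) (sub_nonneg.2 hy1)]
    nlinarith [mul_nonneg hη.le (sq_nonneg (y-1))]

lemma integrable_exp_bdd {Ω : Type*} [MeasurableSpace Ω]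
    (P : Measure Ω) [IsProbabilityMeasure P]
    (X : Ω → ℝ) (hmeas : Measurable X)
    (hbdd : ∀ᵐ ω ∂P, X ω ∈ Set.Icc (-(1/2) : ℝ) (1/2)) (c : ℝ) :
    Integrable (fun ω => Real.exp (c * X ω)) P := by
  refine Integrable.of_bound (C := Real.exp (|c| * (1/2))) (by fun_prop) ?_
  filter_upwards [hbdd] with ω h
  rw [Real.norm_eq_abs, Real.abs_exp]
  apply Real.exp_le_exp.2
  calc c * X ω ≤ |c * X ω| := le_abs_self _
    _ = |c| * |X ω| := abs_mul _ _
    _ ≤ _ := mul_le_mul_of_nonneg_left (abs_le.2 h) (abs_nonneg _)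

/-- Lemma 2 (annealed-to-actual): under the v-central condition with v(γ) = η₀γ^α and
excess loss bounded in [-1/2,1/2], for all γ > 0 and 0 < η ≤ v(γ)/2,
E[R] ≤ C_η · annealed expectation + ((C_η - 1)/η)·v(γ)·γ with C_η = 2 + 2η. -/
theorem central_condition_annealed_to_actual {Ω : Type*} [MeasurableSpace Ω]
    (P : Measure Ω) [IsProbabilityMeasure P]
    (X : Ω → ℝ) (hmeas : Measurable X)
    (hbdd : ∀ᵐ ω ∂P, X ω ∈ Set.Icc (-(1/2) : ℝ) (1/2))
    (η0 α : ℝ) (hη0 : 0 < η0) (hα : 0 ≤ α)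
    (v : ℝ → ℝ) (hv : ∀ γ, v γ = η0 * γ ^ α)
    (hcentral : ∀ γ > 0, ∫ ω, Real.exp (-(v γ) * X ω) ∂P ≤ Real.exp (v γ * γ)) :
    ∀ γ > 0, ∀ η : ℝ, 0 < η → η ≤ v γ / 2 →
      ∫ ω, X ω ∂P ≤
        (2 + 2*η) * (-(1/η) * Real.log (∫ ω, Real.exp (-η * X ω) ∂P))
          + ((2 + 2*η - 1)/η) * (v γ * γ) := by
  intro γ hγ η hη hηv
  have hc := hcentral γ hγ
  have hV : 0 < v γ := by linarith
  have hε : 0 < v γ * γ := mul_pos hV hγ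
  generalize v γ * γ = ε at *
  generalize v γ = V at *
  have hint := integrable_exp_bdd P X hmeas hbdd
  have hX : Integrable X P := by
    refine Integrable.of_bound (C := 1/2) (by fun_prop) ?_
    filter_upwards [hbdd] with ω h
    exact abs_le.2 h
  have hYpos : 0 < ∫ ω, Real.exp (-η * X ω) ∂P := integral_exp_pos (hint _)
  -- second moment
  have hY2 : ∫ ω, Real.exp (-(2*η) * X ω) ∂P ≤ Real.exp ε := by
    have ht1 : 2*η/V ≤ 1 := by rw [div_le_one hV]; linarith
    have ht0 : 0 ≤ 2*η/V := by positivity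
    have hle : ∫ ω, Real.exp (-(2*η) * X ω) ∂P
        ≤ ∫ ω, ((1 - 2*η/V) + (2*η/V) * Real.exp (-V * X ω)) ∂P := by
      refine integral_mono (hint _) ((integrable_const _).add ((hint _).const_mul _)) ?_
      intro ω
      have := convexOn_exp.2 (Set.mem_univ (0:ℝ)) (Set.mem_univ (-V * X ω))
        (sub_nonneg.2 ht1) ht0 (by ring)
      simp only [smul_eq_mul, mul_zero, zero_add, Real.exp_zero, mul_one] at this
      have e : 2*η/V * (-V * X ω) = -(2*η) * X ω := by field_simp
      rw [e] at this
      exact this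
    rw [integral_add (integrable_const _) ((hint _).const_mul _), integral_const_mul] at hle
    simp only [integral_const, probReal_univ, one_smul] at hle
    have h1 : 1 ≤ Real.exp ε := Real.one_le_exp hε.le
    nlinarith [mul_le_mul_of_nonneg_left hc ht0, mul_nonneg (sub_nonneg.2 ht1) (sub_nonneg.2 h1)]
  suffices hmain : η * ∫ ω, X ω ∂P + (2 + 2*η) * Real.log (∫ ω, Real.exp (-η * X ω) ∂P)
      ≤ (1 + 2*η) * ε by
    have e : (2 + 2*η) * (-(1/η) * Real.log (∫ ω, Real.exp (-η * X ω) ∂P))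
          + ((2 + 2*η - 1)/η) * ε
        = ((1 + 2*η) * ε - (2 + 2*η) * Real.log (∫ ω, Real.exp (-η * X ω) ∂P)) / η := by
      field_simp; ring
    rw [e, le_div_iff₀ hη]
    linarith
  rcases le_total ε (1/2) with hs | hs
  · have hsub : ∀ c : ℝ, Integrable (fun ω => Real.exp (c * X ω) - 1) P :=
      fun c => (hint c).sub (integrable_const _)
    have hk : ∫ ω, (η * X ω + (2 + 2*η) * (Real.exp (-η * X ω) - 1)) ∂P
        ≤ ∫ ω, ((1 + 2*η)/2) * (Real.exp (-(2*η) * X ω) - 1) ∂P := by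
      refine integral_mono_ae ((hX.const_mul _).add
        (((hint _).sub (integrable_const _)).const_mul _))
        (((hint _).sub (integrable_const _)).const_mul _) ?_
      filter_upwards [hbdd] with ω h
      exact key_pointwise η _ hη h.2
    rw [integral_add (hX.const_mul _) ((hsub _).const_mul _),
      integral_const_mul, integral_const_mul, integral_const_mul,
      integral_sub (hint _) (integrable_const _), integral_sub (hint _) (integrable_const _)] at hk
    simp only [integral_const, probReal_univ, one_smul] at hk
    have hl := Real.log_le_sub_one_of_pos hYpos
    have he : Real.exp ε ≤ 1 + 2*ε := by
      refine (Real.exp_bound_div_one_sub_of_interval hε.le (by linarith)).trans ?_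
      rw [div_le_iff₀ (by linarith)]
      nlinarith
    nlinarith [mul_le_mul_of_nonneg_left hl (by linarith : 0 ≤ 2 + 2*η),
      mul_le_mul_of_nonneg_left (hY2.trans he) (by linarith : 0 ≤ (1 + 2*η)/2)]
  · have hXle : ∫ ω, X ω ∂P ≤ 1/2 := by
      have := integral_mono_ae hX (integrable_const (1/2 : ℝ))
        (by filter_upwards [hbdd] with ω h using h.2)
      simpa using this
    have hYle : ∫ ω, Real.exp (-η * X ω) ∂P ≤ Real.exp (ε/2) := by
      have ha := Real.exp_pos (ε/2)
      have haa : Real.exp ε = Real.exp (ε/2) * Real.exp (ε/2) := by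
        rw [← Real.exp_add]; congr 1; ring
      rw [haa] at hY2
      generalize Real.exp (ε/2) = a at *
      have hle : ∫ ω, 2 * a * Real.exp (-η * X ω) ∂P
          ≤ ∫ ω, (Real.exp (-(2*η) * X ω) + a * a) ∂P := by
        refine integral_mono ((hint _).const_mul _) ((hint _).add (integrable_const _)) ?_
        intro ω
        have e : Real.exp (-(2*η) * X ω) = Real.exp (-η * X ω) * Real.exp (-η * X ω) := by
          rw [← Real.exp_add]; congr 1; ring
        simp only [e]
        nlinarith [sq_nonneg (Real.exp (-η * X ω) - a)]
      rw [integral_add (hint _) (integrable_const _), integral_const_mul] at hle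
      simp only [integral_const, probReal_univ, one_smul] at hle
      nlinarith
    have hl : Real.log (∫ ω, Real.exp (-η * X ω) ∂P) ≤ ε/2 :=
      (Real.log_le_iff_le_exp hYpos).2 hYle
    nlinarith [mul_le_mul_of_nonneg_left hl (by linarith : 0 ≤ 2 + 2*η),
      mul_le_mul_of_nonneg_left hXle hη.le, mul_le_mul_of_nonneg_left hs hη.le]
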